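/- arXiv:math-ph/0308032 — 4 statements merged into one kernel-verified Lean document; each statement's English description precedes it below -/
import Mathlib

section
/- Let (a_k)_{k≥1} be a sequence of complex numbers with Σ_{k=1}^∞ |a_k| < ∞ and let V(x) = Σ_{k=1}^∞ a_k e^{ikx}. Then for every z ∈ ℂ, the Floquet discriminant satisfies Δ(V;z) = 2cos(2π√z), where √z is any complex square root of z (the value is independent of the choice since cosine is even). -/
noncomputable section

/-- `ψ` is a (twice differentiable) solution of the Hill equation `-ψ'' + V ψ = z ψ` on `ℝ`. -/
def IsHillSolution (V : ℝ → ℂ) (z : ℂ) (ψ : ℝ → ℂ) : Prop :=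
  Differentiable ℝ ψ ∧ Differentiable ℝ (deriv ψ) ∧
    ∀ x : ℝ, -deriv (deriv ψ) x + V x * ψ x = z * ψ x

/-- Coefficients of the periodic factor `∑ b_n e^{inx}` of the Floquet solution
`e^{iwx} ∑ b_n e^{inx}` for the potential `∑ a_k e^{i(k+1)x}`. -/
def floquetCoeff (a : ℕ → ℂ) (w : ℂ) : ℕ → ℂ
  | 0 => 1
  | n + 1 => -(∑ j : Fin (n + 1), floquetCoeff a w j * a (n - j)) /
      (((n : ℂ) + 1) * ((n : ℂ) + 1 + 2 * w))

theorem floquetCoeff_zero (a : ℕ → ℂ) (w : ℂ) : floquetCoeff a w 0 = 1 := by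
  rw [floquetCoeff]

theorem floquetCoeff_succ (a : ℕ → ℂ) (w : ℂ) (n : ℕ) :
    floquetCoeff a w (n + 1) =
      -(∑ j ∈ Finset.range (n + 1), floquetCoeff a w j * a (n - j)) /
        (((n : ℂ) + 1) * ((n : ℂ) + 1 + 2 * w)) := by
  rw [floquetCoeff, Fin.sum_univ_eq_sum_range (fun j => floquetCoeff a w j * a (n - j))]

theorem exists_norm_div_add_le (v : ℂ) :
    ∃ C : ℝ, 0 ≤ C ∧ ∀ n : ℕ, ‖((n : ℂ) + 1) / ((n : ℂ) + 1 + v)‖ ≤ C := by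
  have h : Filter.Tendsto (fun n : ℕ => ((n : ℂ) + 1) / ((n : ℂ) + 1 + v)) Filter.atTop
      (nhds 1) := by
    have h1 : Filter.Tendsto (fun n : ℕ => (1 + v * (1 / ((n : ℂ) + 1)))⁻¹) Filter.atTop
        (nhds ((1 + v * 0)⁻¹)) :=
      ((tendsto_one_div_add_atTop_nhds_zero_nat (𝕜 := ℂ)).const_mul v |>.const_add 1).inv₀
        (by simp)
    simp only [mul_zero, add_zero, inv_one] at h1
    refine h1.congr fun n => ?_
    have hn : (n : ℂ) + 1 ≠ 0 := Nat.cast_add_one_ne_zero n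
    rw [show 1 + v * (1 / ((n : ℂ) + 1)) = ((n : ℂ) + 1 + v) / ((n : ℂ) + 1) by field_simp,
      inv_div]
  obtain ⟨C, hC⟩ := (Metric.isBounded_range_of_tendsto _ h).exists_norm_le
  exact ⟨C, (norm_nonneg _).trans (hC _ ⟨0, rfl⟩), fun n => hC _ ⟨n, rfl⟩⟩

theorem exists_norm_floquetCoeff_succ_le (a : ℕ → ℂ) (w : ℂ) :
    ∃ C : ℝ, 0 ≤ C ∧ ∀ n : ℕ, ((n : ℝ) + 1) ^ 2 * ‖floquetCoeff a w (n + 1)‖ ≤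
      C * ‖∑ j ∈ Finset.range (n + 1), floquetCoeff a w j * a (n - j)‖ := by
  obtain ⟨C, hC0, hC⟩ := exists_norm_div_add_le (2 * w)
  refine ⟨C, hC0, fun n => ?_⟩
  have hn : (n : ℂ) + 1 ≠ 0 := Nat.cast_add_one_ne_zero n
  have hn' : ‖(n : ℂ) + 1‖ = (n : ℝ) + 1 := by
    exact_mod_cast Complex.norm_natCast (n + 1)
  rw [floquetCoeff_succ, ← hn', ← norm_pow, ← norm_mul]
  refine le_trans (le_of_eq ?_) (mul_le_mul_of_nonneg_right (hC n) (norm_nonneg _))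
  rw [← norm_mul, ← norm_neg]
  congr 1
  rw [neg_div, mul_neg, neg_neg, div_mul_eq_div_div, div_mul_eq_mul_div]
  field_simp

theorem summable_norm_floquetCoeff (a : ℕ → ℂ) (ha : Summable fun k => ‖a k‖) (w : ℂ) :
    Summable fun n => ‖floquetCoeff a w n‖ := by
  obtain ⟨C, hC0, hC⟩ := exists_norm_floquetCoeff_succ_le a w
  set A := ∑' k, ‖a k‖
  have hA : ∀ k, ‖a k‖ ≤ A := fun k => ha.le_tsum k fun _ _ => norm_nonneg _
  have hA0 : 0 ≤ A := tsum_nonneg fun _ => norm_nonneg _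
  set ε : ℕ → ℝ := fun n => C * A * (1 / ((n : ℝ) + 1) ^ 2) with hε
  have hε0 : ∀ n, 0 ≤ ε n := fun n => by positivity
  have hεs : Summable ε := by
    have := (summable_nat_add_iff 1).2 (Real.summable_one_div_nat_pow.2 (one_lt_two))
    push_cast at this
    exact this.mul_left (C * A)
  set S : ℕ → ℝ := fun n => ∑ j ∈ Finset.range n, ‖floquetCoeff a w j‖ with hS
  have hstep : ∀ n, ‖floquetCoeff a w (n + 1)‖ ≤ ε n * S (n + 1) := by
    intro n
    have h1 : ‖∑ j ∈ Finset.range (n + 1), floquetCoeff a w j * a (n - j)‖ ≤ A * S (n + 1) := by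
      refine (norm_sum_le _ _).trans ?_
      rw [hS, Finset.mul_sum]
      refine Finset.sum_le_sum fun j _ => ?_
      rw [norm_mul, mul_comm]
      exact mul_le_mul_of_nonneg_right (hA _) (norm_nonneg _)
    have h2 := (hC n).trans (mul_le_mul_of_nonneg_left h1 hC0)
    have hpos : (0 : ℝ) < ((n : ℝ) + 1) ^ 2 := by positivity
    rw [mul_comm, ← le_div_iff₀ hpos] at h2
    refine h2.trans (le_of_eq ?_)
    rw [hε]
    ring
  have hbound : ∀ n, S (n + 1) ≤ Real.exp (∑ k ∈ Finset.range n, ε k) := by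
    intro n
    induction n with
    | zero => simp [hS, floquetCoeff_zero]
    | succ n ih =>
      have hS0 : 0 ≤ S (n + 1) := Finset.sum_nonneg fun _ _ => norm_nonneg _
      calc S (n + 1 + 1) = S (n + 1) + ‖floquetCoeff a w (n + 1)‖ := by
            rw [hS]; exact Finset.sum_range_succ _ _
        _ ≤ S (n + 1) * (ε n + 1) := by linarith [hstep n]
        _ ≤ Real.exp (∑ k ∈ Finset.range n, ε k) * Real.exp (ε n) :=
            mul_le_mul ih (Real.add_one_le_exp _) (by linarith [hε0 n]) (Real.exp_nonneg _)
        _ = Real.exp (∑ k ∈ Finset.range (n + 1), ε k) := by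
            rw [← Real.exp_add, Finset.sum_range_succ]
  refine summable_of_sum_range_le (c := Real.exp (∑' k, ε k)) (fun _ => norm_nonneg _) fun n => ?_
  calc S n ≤ S (n + 1) :=
        Finset.sum_le_sum_of_subset_of_nonneg (Finset.range_mono (Nat.le_succ n))
          fun _ _ _ => norm_nonneg _
    _ ≤ Real.exp (∑ k ∈ Finset.range n, ε k) := hbound n
    _ ≤ Real.exp (∑' k, ε k) := Real.exp_le_exp.2 (hεs.sum_le_tsum _ fun k _ => hε0 k)

theorem summable_sq_mul_norm_floquetCoeff (a : ℕ → ℂ) (ha : Summable fun k => ‖a k‖) (w : ℂ) :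
    Summable fun n : ℕ => (n : ℝ) ^ 2 * ‖floquetCoeff a w n‖ := by
  obtain ⟨C, hC0, hC⟩ := exists_norm_floquetCoeff_succ_le a w
  rw [← summable_nat_add_iff 1]
  push_cast
  exact Summable.of_nonneg_of_le (fun n => by positivity) hC
    ((summable_norm_sum_mul_range_of_summable_norm
      (summable_norm_floquetCoeff a ha w) ha).mul_left C)

theorem norm_cexp_I_mul_natCast_mul (n : ℕ) (x : ℝ) :
    ‖Complex.exp (Complex.I * (n : ℂ) * (x : ℂ))‖ = 1 := by
  rw [show Complex.I * (n : ℂ) * (x : ℂ) = ((n * x : ℝ) : ℂ) * Complex.I by push_cast; ring]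
  exact Complex.norm_exp_ofReal_mul_I _

theorem hasDerivAt_tsum_mul_cexp (b : ℕ → ℂ) (hb : Summable fun n => ‖b n‖)
    (hb' : Summable fun n : ℕ => (n : ℝ) * ‖b n‖) (x : ℝ) :
    HasDerivAt (fun x : ℝ => ∑' n : ℕ, b n * Complex.exp (Complex.I * (n : ℂ) * (x : ℂ)))
      (∑' n : ℕ, Complex.I * n * b n * Complex.exp (Complex.I * (n : ℂ) * (x : ℂ))) x := by
  refine hasDerivAt_tsum (y₀ := (0 : ℝ))
    (g := fun (n : ℕ) (x : ℝ) => b n * Complex.exp (Complex.I * (n : ℂ) * (x : ℂ)))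
    (g' := fun (n : ℕ) (x : ℝ) =>
      Complex.I * n * b n * Complex.exp (Complex.I * (n : ℂ) * (x : ℂ)))
    hb' (fun n y => ?_) (fun n y => ?_) ?_ x
  · have h1 : HasDerivAt (fun y : ℝ => Complex.I * (n : ℂ) * (y : ℂ)) (Complex.I * (n : ℂ)) y := by
      simpa using (Complex.ofRealCLM.hasDerivAt (x := y)).const_mul (Complex.I * (n : ℂ))
    exact (h1.cexp.const_mul (b n)).congr_deriv (by ring)
  · rw [norm_mul, norm_cexp_I_mul_natCast_mul]
    simp
  · simpa using hb.of_norm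

theorem integral_cexp_I_mul_natCast_succ (n : ℕ) :
    ∫ x in (0 : ℝ)..(2 * Real.pi), Complex.exp (Complex.I * ((n + 1 : ℕ) : ℂ) * (x : ℂ)) = 0 := by
  have hn : Complex.I * ((n + 1 : ℕ) : ℂ) ≠ 0 :=
    mul_ne_zero Complex.I_ne_zero (Nat.cast_ne_zero.2 n.succ_ne_zero)
  rw [integral_exp_mul_complex hn]
  have : Complex.exp (Complex.I * ((n + 1 : ℕ) : ℂ) * ((2 * Real.pi : ℝ) : ℂ)) = 1 :=
    Complex.exp_eq_one_iff.2 ⟨(n + 1 : ℕ), by push_cast; ring⟩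
  rw [this]
  simp

theorem exists_tsum_mul_cexp_ne_zero (b : ℕ → ℂ) (hb : Summable fun n => ‖b n‖) (hb0 : b 0 ≠ 0) :
    ∃ x : ℝ, ∑' n : ℕ, b n * Complex.exp (Complex.I * (n : ℂ) * (x : ℂ)) ≠ 0 := by
  by_contra! h
  have hint : HasSum
      (fun n : ℕ => ∫ x in (0 : ℝ)..(2 * Real.pi),
        b n * Complex.exp (Complex.I * (n : ℂ) * (x : ℂ)))
      (∫ x in (0 : ℝ)..(2 * Real.pi),
        ∑' n : ℕ, b n * Complex.exp (Complex.I * (n : ℂ) * (x : ℂ))) := by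
    refine intervalIntegral.hasSum_integral_of_dominated_convergence (fun n _ => ‖b n‖)
      (fun n => ?_) (fun n => ?_) ?_ ?_ ?_
    · exact Continuous.aestronglyMeasurable (by fun_prop)
    · refine Filter.Eventually.of_forall fun x _ => ?_
      rw [norm_mul, norm_cexp_I_mul_natCast_mul, mul_one]
    · exact Filter.Eventually.of_forall fun x _ => hb
    · exact intervalIntegrable_const
    · refine Filter.Eventually.of_forall fun x _ => Summable.hasSum (Summable.of_norm ?_)
      simpa only [norm_mul, norm_cexp_I_mul_natCast_mul, mul_one] using hb
  have h0 := hint.unique (hasSum_single 0 fun n hn => by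
    obtain ⟨m, rfl⟩ := Nat.exists_eq_succ_of_ne_zero hn
    rw [intervalIntegral.integral_const_mul, Nat.succ_eq_add_one,
      integral_cexp_I_mul_natCast_succ, mul_zero])
  simp [h, hb0, Real.pi_ne_zero] at h0

theorem IsHillSolution.wronskian_eq {V : ℝ → ℂ} {z : ℂ} {φ ψ : ℝ → ℂ}
    (hφ : IsHillSolution V z φ) (hψ : IsHillSolution V z ψ) (x : ℝ) :
    φ x * deriv ψ x - deriv φ x * ψ x = φ 0 * deriv ψ 0 - deriv φ 0 * ψ 0 := by
  have hd : ∀ y, HasDerivAt (fun y => φ y * deriv ψ y - deriv φ y * ψ y) 0 y := fun y => by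
    refine (((hφ.1 y).hasDerivAt.mul (hψ.2.1 y).hasDerivAt).sub
      ((hφ.2.1 y).hasDerivAt.mul (hψ.1 y).hasDerivAt)).congr_deriv ?_
    linear_combination ψ y * hφ.2.2 y - φ y * hψ.2.2 y
  exact is_const_of_deriv_eq_zero (fun y => (hd y).differentiableAt) (fun y => (hd y).deriv) x 0

/-- A nonzero solution with Floquet multiplier `μ` determines the Floquet discriminant. -/
theorem IsHillSolution.discriminant_mul_eq {V : ℝ → ℂ} {z : ℂ} {c s ψ : ℝ → ℂ}
    (hc : IsHillSolution V z c) (hc0 : c 0 = 1) (hc0' : deriv c 0 = 0)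
    (hs : IsHillSolution V z s) (hs0 : s 0 = 0) (hs0' : deriv s 0 = 1)
    (hψ : IsHillSolution V z ψ) {T : ℝ} {μ : ℂ} (hT : ψ T = μ * ψ 0)
    (hT' : deriv ψ T = μ * deriv ψ 0) (hne : ∃ x, ψ x ≠ 0) :
    (c T + deriv s T) * μ = μ ^ 2 + 1 := by
  have hcs : ∀ x, c x * deriv s x - deriv c x * s x = 1 := fun x => by
    rw [hc.wronskian_eq hs x, hc0, hc0', hs0, hs0']; ring
  have h1 : ∀ x, ψ x * deriv s x - deriv ψ x * s x = ψ 0 := fun x => by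
    rw [hψ.wronskian_eq hs x, hs0, hs0']; ring
  have h2 : ∀ x, ψ x * deriv c x - deriv ψ x * c x = -deriv ψ 0 := fun x => by
    rw [hψ.wronskian_eq hc x, hc0, hc0']; ring
  have h3 : ∀ x, ψ x = ψ 0 * c x + deriv ψ 0 * s x := fun x => by
    linear_combination (-ψ x) * hcs x + c x * h1 x - s x * h2 x
  have h1T := h1 T
  have h2T := h2 T
  rw [hT, hT'] at h1T h2T
  have hψ0 : ψ 0 * ((c T + deriv s T) * μ - (μ ^ 2 + 1)) = 0 := by
    linear_combination (1 - μ * c T) * h1T + μ * s T * h2T + μ ^ 2 * ψ 0 * hcs T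
  have hψ0' : deriv ψ 0 * ((c T + deriv s T) * μ - (μ ^ 2 + 1)) = 0 := by
    linear_combination (-(1 - μ * deriv s T)) * h2T - μ * deriv c T * h1T
      + μ ^ 2 * deriv ψ 0 * hcs T
  by_contra hcon
  have hcon' := sub_ne_zero.2 hcon
  obtain ⟨x, hx⟩ := hne
  apply hx
  rw [h3 x, (mul_eq_zero.1 hψ0).resolve_right hcon', (mul_eq_zero.1 hψ0').resolve_right hcon']
  ring

theorem exists_floquet_solution (a : ℕ → ℂ) (ha : Summable fun k => ‖a k‖) (V : ℝ → ℂ)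
    (hV : ∀ x : ℝ, V x = ∑' k : ℕ, a k * Complex.exp (Complex.I * ((k : ℂ) + 1) * (x : ℂ)))
    (w : ℂ) (hw : ∀ n : ℕ, (n : ℂ) + 1 + 2 * w ≠ 0) :
    ∃ ψ : ℝ → ℂ, IsHillSolution V (w ^ 2) ψ ∧
      (∀ x, ψ (x + 2 * Real.pi) = Complex.exp (2 * Real.pi * w * Complex.I) * ψ x) ∧
      ∃ x, ψ x ≠ 0 := by
  set b := floquetCoeff a w with hbdef
  have hb : Summable fun n => ‖b n‖ := summable_norm_floquetCoeff a ha w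
  have hb2 : Summable fun n : ℕ => (n : ℝ) ^ 2 * ‖b n‖ := summable_sq_mul_norm_floquetCoeff a ha w
  have hb1 : Summable fun n : ℕ => (n : ℝ) * ‖b n‖ := by
    refine Summable.of_nonneg_of_le (fun n => by positivity) (fun n => ?_) hb2
    refine mul_le_mul_of_nonneg_right ?_ (norm_nonneg _)
    exact_mod_cast Nat.le_self_pow two_ne_zero n
  set e : ℕ → ℝ → ℂ := fun n x => Complex.exp (Complex.I * (n : ℂ) * (x : ℂ)) with he
  have hsum : ∀ (f : ℕ → ℂ) (x : ℝ), (Summable fun n => ‖f n‖) → Summable fun n => ‖f n * e n x‖ :=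
    fun f x hf => by simpa only [he, norm_mul, norm_cexp_I_mul_natCast_mul, mul_one] using hf
  set p : ℝ → ℂ := fun x => ∑' n : ℕ, b n * e n x with hp
  set p₁ : ℝ → ℂ := fun x => ∑' n : ℕ, Complex.I * n * b n * e n x with hp₁
  set p₂ : ℝ → ℂ := fun x => ∑' n : ℕ, Complex.I * n * (Complex.I * n * b n) * e n x with hp₂
  have hdp : ∀ x, HasDerivAt p (p₁ x) x := fun x => hasDerivAt_tsum_mul_cexp b hb hb1 x
  have hs1 : Summable fun n : ℕ => ‖Complex.I * n * b n‖ := by simpa using hb1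
  have hs2 : Summable fun n : ℕ => ‖Complex.I * n * (Complex.I * n * b n)‖ := by
    refine hb2.congr fun n => ?_
    simp only [norm_mul, Complex.norm_I, Complex.norm_natCast]
    ring
  have hdp₁ : ∀ x, HasDerivAt p₁ (p₂ x) x := fun x =>
    hasDerivAt_tsum_mul_cexp (fun n : ℕ => Complex.I * n * b n) hs1
      (hs2.congr fun n => by simp only [norm_mul, Complex.norm_I, Complex.norm_natCast]; ring) x
  have hode : ∀ x, p₂ x + 2 * Complex.I * w * p₁ x = V x * p x := by
    intro x
    have hV' : V x = e 1 x * ∑' k : ℕ, a k * e k x := by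
      rw [hV, ← tsum_mul_left]
      refine tsum_congr fun k => ?_
      simp only [he]
      rw [mul_left_comm, ← Complex.exp_add]
      congr 2
      push_cast
      ring
    have hprod := tsum_mul_tsum_eq_tsum_sum_range_of_summable_norm (hsum b x hb) (hsum a x ha)
    have hVp : V x * p x = e 1 x * ((∑' n : ℕ, b n * e n x) * ∑' n : ℕ, a n * e n x) := by
      rw [hV', mul_assoc, mul_comm (p x)]
    have hl : p₂ x + 2 * Complex.I * w * p₁ x =
        ∑' n : ℕ, (Complex.I * n * (Complex.I * n * b n) * e n x +
          2 * Complex.I * w * (Complex.I * n * b n * e n x)) := by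
      rw [Summable.tsum_add (hsum _ x hs2).of_norm ((hsum _ x hs1).of_norm.mul_left _),
        tsum_mul_left]
    have hsl : Summable fun n : ℕ => (Complex.I * n * (Complex.I * n * b n) * e n x +
          2 * Complex.I * w * (Complex.I * n * b n * e n x)) :=
      (hsum _ x hs2).of_norm.add ((hsum _ x hs1).of_norm.mul_left _)
    rw [hl, hsl.tsum_eq_zero_add, hVp, hprod, ← tsum_mul_left]
    simp only [Nat.cast_zero, mul_zero, zero_mul, add_zero, zero_add]
    refine tsum_congr fun n => ?_
    have h1 : ∑ k ∈ Finset.range (n + 1), b k * e k x * (a (n - k) * e (n - k) x) =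
        (∑ k ∈ Finset.range (n + 1), b k * a (n - k)) * e n x := by
      rw [Finset.sum_mul]
      refine Finset.sum_congr rfl fun k hk => ?_
      have hkn : k ≤ n := Nat.lt_succ_iff.1 (Finset.mem_range.1 hk)
      have : e n x = e k x * e (n - k) x := by
        simp only [he]
        rw [← Complex.exp_add]
        congr 1
        push_cast [hkn]
        ring
      rw [this]
      ring
    have h2 : e (n + 1) x = e 1 x * e n x := by
      simp only [he]
      rw [← Complex.exp_add]
      congr 1
      push_cast
      ring
    have h3 : ((n : ℂ) + 1) * ((n : ℂ) + 1 + 2 * w) * b (n + 1) =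
        -∑ k ∈ Finset.range (n + 1), b k * a (n - k) := by
      rw [hbdef, floquetCoeff_succ]
      exact mul_div_cancel₀ _ (mul_ne_zero (Nat.cast_add_one_ne_zero n) (hw n))
    rw [h1, h2]
    push_cast
    linear_combination (-e 1 x * e n x) * h3 + ((n : ℂ) + 1) * ((n : ℂ) + 1 + 2 * w) * b (n + 1) *
      e 1 x * e n x * Complex.I_sq
  set E : ℝ → ℂ := fun x => Complex.exp (Complex.I * w * (x : ℂ)) with hE
  have hdE : ∀ x, HasDerivAt E (Complex.I * w * E x) x := fun x => by
    have h1 : HasDerivAt (fun y : ℝ => Complex.I * w * (y : ℂ)) (Complex.I * w) x := by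
      simpa using (Complex.ofRealCLM.hasDerivAt (x := x)).const_mul (Complex.I * w)
    exact h1.cexp.congr_deriv (mul_comm _ _)
  have hd1 : ∀ x, HasDerivAt (fun x => E x * p x) (E x * (Complex.I * w * p x + p₁ x)) x :=
    fun x => ((hdE x).mul (hdp x)).congr_deriv (by ring)
  have hd1' : deriv (fun x => E x * p x) = fun x => E x * (Complex.I * w * p x + p₁ x) :=
    funext fun x => (hd1 x).deriv
  have hd2 : ∀ x, HasDerivAt (fun x => E x * (Complex.I * w * p x + p₁ x))
      (E x * (-w ^ 2 * p x + 2 * Complex.I * w * p₁ x + p₂ x)) x := fun x => by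
    refine ((hdE x).mul (((hdp x).const_mul (Complex.I * w)).add (hdp₁ x))).congr_deriv ?_
    simp only [Pi.add_apply]
    linear_combination w ^ 2 * E x * p x * Complex.I_sq
  refine ⟨fun x => E x * p x, ⟨fun x => (hd1 x).differentiableAt, ?_, fun x => ?_⟩, fun x => ?_, ?_⟩
  · rw [hd1']
    exact fun x => (hd2 x).differentiableAt
  · rw [hd1', (hd2 x).deriv]
    linear_combination (-E x) * hode x
  · have hpp : p (x + 2 * Real.pi) = p x := by
      refine tsum_congr fun n => ?_
      congr 1
      exact Complex.exp_eq_exp_iff_exists_int.2 ⟨n, by push_cast; ring⟩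
    simp only [hpp, ← mul_assoc]
    simp only [hE]
    rw [← Complex.exp_add]
    congr 2
    push_cast
    ring
  · obtain ⟨x, hx⟩ := exists_tsum_mul_cexp_ne_zero b hb (by simp [hbdef, floquetCoeff_zero])
    exact ⟨x, mul_ne_zero (Complex.exp_ne_zero _) hx⟩

theorem exists_eq_or_eq_neg_forall_natCast_add_ne_zero (w : ℂ) :
    ∃ v : ℂ, (v = w ∨ v = -w) ∧ ∀ n : ℕ, (n : ℂ) + 1 + 2 * v ≠ 0 := by
  by_cases h : 0 ≤ w.re
  · refine ⟨w, Or.inl rfl, fun n hn => ?_⟩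
    have := congrArg Complex.re hn
    simp at this
    linarith [(n.cast_nonneg : (0 : ℝ) ≤ n)]
  · refine ⟨-w, Or.inr rfl, fun n hn => ?_⟩
    have := congrArg Complex.re hn
    simp at this
    linarith [(n.cast_nonneg : (0 : ℝ) ≤ n)]

/-- For `V(x) = ∑_{k=1}^∞ a_k e^{ikx}` with `∑ |a_k| < ∞`, the Floquet discriminant
`Δ(V;z) = c(V;z,2π) + s'(V;z,2π)` equals `2 cos(2π√z)` for every `z ∈ ℂ`. -/
theorem floquet_discriminant_eq_two_cos
    (a : ℕ → ℂ) (ha : Summable fun k => ‖a k‖)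
    (V : ℝ → ℂ)
    (hV : ∀ x : ℝ, V x = ∑' k : ℕ, a k * Complex.exp (Complex.I * ((k : ℂ) + 1) * (x : ℂ)))
    (z w : ℂ) (hw : w ^ 2 = z)
    (c s : ℝ → ℂ)
    (hc : IsHillSolution V z c) (hc0 : c 0 = 1) (hc0' : deriv c 0 = 0)
    (hs : IsHillSolution V z s) (hs0 : s 0 = 0) (hs0' : deriv s 0 = 1) :
    c (2 * Real.pi) + deriv s (2 * Real.pi) = 2 * Complex.cos (2 * (Real.pi : ℂ) * w) := by
  obtain ⟨v, hv, hvn⟩ := exists_eq_or_eq_neg_forall_natCast_add_ne_zero w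
  have hvz : v ^ 2 = z := by rcases hv with rfl | rfl <;> simp [← hw]
  have hcos : Complex.cos (2 * (Real.pi : ℂ) * w) = Complex.cos (2 * Real.pi * v) := by
    rcases hv with rfl | rfl <;> simp
  obtain ⟨ψ, hψ, hper, hne⟩ := exists_floquet_solution a ha V hV v hvn
  rw [hvz] at hψ
  have hper0 := hper 0
  have hper' : deriv ψ (2 * Real.pi) =
      Complex.exp (2 * Real.pi * v * Complex.I) * deriv ψ 0 := by
    have h1 : deriv (fun x => ψ (x + 2 * Real.pi)) 0 =
        deriv (fun x => Complex.exp (2 * Real.pi * v * Complex.I) * ψ x) 0 := by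
      rw [funext hper]
    rwa [deriv_comp_add_const, deriv_const_mul _ (hψ.1 0), zero_add] at h1
  rw [zero_add] at hper0
  have hmain := hc.discriminant_mul_eq hc0 hc0' hs hs0 hs0' hψ hper0 hper' hne
  have hexp := Complex.exp_ne_zero (2 * Real.pi * v * Complex.I)
  refine mul_right_cancel₀ hexp (hmain.trans ?_)
  rw [hcos, Complex.two_cos, add_mul, neg_mul, Complex.exp_neg, inv_mul_cancel₀ hexp]
  ring
end
end

section
/- Let V : ℝ → ℂ be continuous and 2π-periodic and let z ∈ ℂ. Then the following are equivalent: (a) there exist a solution ψ of −ψ'' + Vψ = zψ, not identically zero, and ρ ∈ ℂ with |ρ| = 1 such that ψ(x + 2π) = ρ·ψ(x) for all x ∈ ℝ; (b) the equation −ψ'' + Vψ = zψ has a nontrivial bounded solution on ℝ. -/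
noncomputable section

open Function Filter Topology

theorem Function.Periodic.exists_norm_le_of_continuous {E : Type*} [NormedAddCommGroup E]
    {f : ℝ → E} {c : ℝ} (hf : Periodic f c) (hc : c ≠ 0) (hcont : Continuous f) :
    ∃ M : ℝ, ∀ x, ‖f x‖ ≤ M := by
  obtain ⟨M, hM⟩ := isBounded_iff_forall_norm_le.1 (hf.isBounded_of_continuous hc hcont)
  exact ⟨M, fun x => hM _ ⟨x, rfl⟩⟩

namespace IsHillSolution

variable {V : ℝ → ℂ} {z : ℂ} {ψ φ : ℝ → ℂ}

theorem zero : IsHillSolution V z 0 := by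
  have h : deriv (0 : ℝ → ℂ) = 0 := by ext x; exact deriv_const x (0 : ℂ)
  refine ⟨differentiable_const 0, ?_, fun x => ?_⟩
  · rw [h]; exact differentiable_const 0
  · rw [h, h]; simp

theorem add (hψ : IsHillSolution V z ψ) (hφ : IsHillSolution V z φ) :
    IsHillSolution V z (ψ + φ) := by
  have h : deriv (ψ + φ) = deriv ψ + deriv φ := by
    ext x; exact deriv_add (hψ.1 x) (hφ.1 x)
  refine ⟨hψ.1.add hφ.1, ?_, fun x => ?_⟩
  · rw [h]; exact hψ.2.1.add hφ.2.1
  · rw [h, deriv_add (hψ.2.1 x) (hφ.2.1 x)]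
    simp only [Pi.add_apply]
    linear_combination hψ.2.2 x + hφ.2.2 x

theorem const_smul (c : ℂ) (hψ : IsHillSolution V z ψ) : IsHillSolution V z (c • ψ) := by
  have h : deriv (c • ψ) = c • deriv ψ := by
    ext x; exact deriv_const_smul c (hψ.1 x)
  refine ⟨hψ.1.const_smul c, ?_, fun x => ?_⟩
  · rw [h]; exact hψ.2.1.const_smul c
  · rw [h, deriv_const_smul c (hψ.2.1 x)]
    simp only [Pi.smul_apply, smul_eq_mul]
    linear_combination c * hψ.2.2 x

theorem comp_add_const {c : ℝ} (hV : Periodic V c) (hψ : IsHillSolution V z ψ) :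
    IsHillSolution V z fun x => ψ (x + c) := by
  have h : deriv (fun x => ψ (x + c)) = fun x => deriv ψ (x + c) := by
    ext x; exact deriv_comp_add_const ..
  refine ⟨hψ.1.comp (differentiable_id.add_const c), ?_, fun x => ?_⟩
  · rw [h]; exact hψ.2.1.comp (differentiable_id.add_const c)
  · rw [h, deriv_comp_add_const, ← hV x]
    exact hψ.2.2 (x + c)

/-- A Hill solution with bounded potential is determined by its Cauchy data at `x₀`. -/
theorem eq_of_cauchyData_eq {M : ℝ} (hM : ∀ x, ‖V x‖ ≤ M) (hψ : IsHillSolution V z ψ)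
    (hφ : IsHillSolution V z φ) {x₀ : ℝ} (h₀ : ψ x₀ = φ x₀) (h₁ : deriv ψ x₀ = deriv φ x₀) :
    ψ = φ := by
  set v : ℝ → ℂ × ℂ → ℂ × ℂ := fun t p => (p.2, (V t - z) * p.1)
  set K : ℝ := max 1 (M + ‖z‖)
  have hv (t : ℝ) : LipschitzOnWith K.toNNReal (v t) Set.univ := by
    refine LipschitzOnWith.of_dist_le_mul fun p _ q _ => ?_
    rw [Real.coe_toNNReal _ (zero_le_one.trans (le_max_left _ _)), Prod.dist_eq, Prod.dist_eq]
    refine max_le ?_ ?_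
    · calc dist p.2 q.2 ≤ max (dist p.1 q.1) (dist p.2 q.2) := le_max_right _ _
        _ ≤ K * max (dist p.1 q.1) (dist p.2 q.2) :=
          le_mul_of_one_le_left (le_max_of_le_left dist_nonneg) (le_max_left _ _)
    · calc dist ((V t - z) * p.1) ((V t - z) * q.1) = ‖V t - z‖ * dist p.1 q.1 := by
            rw [dist_eq_norm, ← mul_sub, norm_mul, dist_eq_norm]
        _ ≤ K * max (dist p.1 q.1) (dist p.2 q.2) := by
          gcongr
          · exact (norm_sub_le _ _).trans <|
              (add_le_add_left (hM t) _).trans (le_max_right _ _)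
          · exact le_max_left _ _
  have key {χ : ℝ → ℂ} (hχ : IsHillSolution V z χ) (t : ℝ) :
      HasDerivAt (fun x => (χ x, deriv χ x)) (v t (χ t, deriv χ t)) t ∧
        (χ t, deriv χ t) ∈ Set.univ := by
    refine ⟨(hχ.1 t).hasDerivAt.prodMk ?_, trivial⟩
    have h : (V t - z) * χ t = deriv (deriv χ) t := by linear_combination hχ.2.2 t
    rw [h]
    exact (hχ.2.1 t).hasDerivAt
  have h := ODE_solution_unique_univ hv (key hψ) (key hφ) (t₀ := x₀) (by rw [h₀, h₁])
  ext x
  exact congrArg Prod.fst (congrFun h x)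

end IsHillSolution

/-- The space of bounded solutions of the Hill equation. -/
def boundedHillSolutions (V : ℝ → ℂ) (z : ℂ) : Submodule ℂ (ℝ → ℂ) where
  carrier := {ψ | IsHillSolution V z ψ ∧ ∃ M : ℝ, ∀ x, ‖ψ x‖ ≤ M}
  zero_mem' := ⟨.zero, 0, by simp⟩
  add_mem' := by
    rintro ψ φ ⟨hψ, M, hM⟩ ⟨hφ, N, hN⟩
    exact ⟨hψ.add hφ, M + N, fun x => norm_add_le_of_le (hM x) (hN x)⟩
  smul_mem' := by
    rintro c ψ ⟨hψ, M, hM⟩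
    refine ⟨hψ.const_smul c, ‖c‖ * M, fun x => ?_⟩
    rw [Pi.smul_apply, norm_smul]
    gcongr
    exact hM x

theorem finiteDimensional_boundedHillSolutions {V : ℝ → ℂ} {M : ℝ} (hM : ∀ x, ‖V x‖ ≤ M)
    (z : ℂ) : FiniteDimensional ℂ (boundedHillSolutions V z) := by
  let cauchyData : boundedHillSolutions V z →ₗ[ℂ] ℂ × ℂ :=
    { toFun := fun ψ => (ψ.1 0, deriv ψ.1 0)
      map_add' := fun ψ φ => Prod.ext rfl (deriv_add (ψ.2.1.1 0) (φ.2.1.1 0))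
      map_smul' := fun c ψ => Prod.ext rfl (deriv_const_smul c (ψ.2.1.1 0)) }
  refine Module.Finite.of_injective cauchyData fun ψ φ h => Subtype.ext ?_
  exact ψ.2.1.eq_of_cauchyData_eq hM φ.2.1 (congrArg Prod.fst h) (congrArg Prod.snd h)

/-- Translation by a period of the potential, acting on bounded Hill solutions. -/
def hillTranslation {V : ℝ → ℂ} {c : ℝ} (hV : Periodic V c) (z : ℂ) :
    Module.End ℂ (boundedHillSolutions V z) where
  toFun ψ := ⟨fun x => ψ.1 (x + c), ψ.2.1.comp_add_const hV,
    ψ.2.2.imp fun _ h x => h (x + c)⟩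
  map_add' _ _ := rfl
  map_smul' _ _ := rfl

/-- A bounded nonzero function on `ℝ` that is multiplied by `ρ` under a translation
has `‖ρ‖ = 1`. -/
theorem norm_multiplier_eq_one {ψ : ℝ → ℂ} {ρ : ℂ} {c M : ℝ} (hM : ∀ x, ‖ψ x‖ ≤ M)
    (h0 : ψ ≠ 0) (hρ : ∀ x, ψ (x + c) = ρ * ψ x) : ‖ρ‖ = 1 := by
  obtain ⟨x, hx⟩ := Function.ne_iff.1 h0
  have hx' : 0 < ‖ψ x‖ := norm_pos_iff.2 hx
  have iter (n : ℕ) (y : ℝ) : ψ (y + n * c) = ρ ^ n * ψ y := by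
    induction n with
    | zero => simp
    | succ n ih =>
      have : y + (n + 1 : ℕ) * c = y + n * c + c := by push_cast; ring
      rw [this, hρ, ih, pow_succ]; ring
  apply le_antisymm
  · by_contra! h
    obtain ⟨n, hn⟩ := pow_unbounded_of_one_lt (M / ‖ψ x‖) h
    rw [div_lt_iff₀ hx', ← norm_pow, ← norm_mul, ← iter] at hn
    exact hn.not_ge (hM _)
  · by_contra! h
    have hlim : Tendsto (fun n : ℕ => ‖ρ‖ ^ n * M) atTop (𝓝 0) := by
      simpa using (tendsto_pow_atTop_nhds_zero_of_lt_one (norm_nonneg ρ) h).mul_const M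
    refine hx'.not_ge (ge_of_tendsto' hlim fun n => ?_)
    have hn := iter n (x - n * c)
    rw [sub_add_cancel] at hn
    rw [hn, norm_mul, norm_pow]
    gcongr
    exact hM _

/-- For continuous `2π`-periodic `V` and `z ∈ ℂ`: there is a nontrivial Floquet solution
with unimodular multiplier iff the Hill equation has a nontrivial bounded solution. -/
theorem floquet_unimodular_iff_bounded_solution
    (V : ℝ → ℂ) (hVcont : Continuous V)
    (hVper : ∀ x : ℝ, V (x + 2 * Real.pi) = V x)
    (z : ℂ) :
    (∃ (ψ : ℝ → ℂ) (ρ : ℂ), IsHillSolution V z ψ ∧ ψ ≠ 0 ∧ ‖ρ‖ = 1 ∧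
        ∀ x : ℝ, ψ (x + 2 * Real.pi) = ρ * ψ x) ↔
      ∃ ψ : ℝ → ℂ, IsHillSolution V z ψ ∧ ψ ≠ 0 ∧ ∃ M : ℝ, ∀ x : ℝ, ‖ψ x‖ ≤ M := by
  constructor
  · rintro ⟨ψ, ρ, hψ, h0, hρ, hper⟩
    have hnorm : Periodic (fun x => ‖ψ x‖) (2 * Real.pi) := fun x => by
      simp [hper, hρ]
    obtain ⟨M, hM⟩ :=
      hnorm.exists_norm_le_of_continuous Real.two_pi_pos.ne' hψ.1.continuous.norm
    exact ⟨ψ, hψ, h0, M, fun x => by simpa using hM x⟩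
  · rintro ⟨ψ, hψ, h0, hbdd⟩
    obtain ⟨C, hC⟩ :=
      Periodic.exists_norm_le_of_continuous hVper Real.two_pi_pos.ne' hVcont
    have := finiteDimensional_boundedHillSolutions hC z
    have : Nontrivial (boundedHillSolutions V z) :=
      ⟨⟨ψ, hψ, hbdd⟩, 0, fun h => h0 (congrArg Subtype.val h)⟩
    obtain ⟨ρ, hρ⟩ := Module.End.exists_eigenvalue (hillTranslation hVper z)
    obtain ⟨φ, hφ⟩ := hρ.exists_hasEigenvector
    have hφ0 : φ.1 ≠ 0 := fun h => hφ.2 (Subtype.ext h)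
    have hper (x : ℝ) : φ.1 (x + 2 * Real.pi) = ρ * φ.1 x :=
      congrFun (congrArg Subtype.val hφ.apply_eq_smul) x
    obtain ⟨M, hM⟩ := φ.2.2
    exact ⟨φ.1, ρ, φ.2.1, hφ0, norm_multiplier_eq_one hM hφ0 hper, hper⟩
end
end

section
/- Let V : ℝ → ℂ be continuous and 2π-periodic, let z ∈ ℂ and n a positive integer, and let ρ ∈ ℂ \ {0} be a Floquet multiplier for the equation −ψ'' + Vψ = zψ (i.e., some nontrivial solution ψ satisfies ψ(x+2π) = ρψ(x) for all x). Set q_n(x) = n²·V(nx). Then the Floquet discriminant of q_n at spectral parameter w = n²z satisfies Δ(q_n; n²z) = ρⁿ + ρ⁻ⁿ. -/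
noncomputable section

/-- The Wronskian of two solutions of the same Hill equation is constant. -/
theorem IsHillSolution.wronskian_eq_s6 {V : ℝ → ℂ} {z : ℂ} {f g : ℝ → ℂ}
    (hf : IsHillSolution V z f) (hg : IsHillSolution V z g) (x y : ℝ) :
    f x * deriv g x - deriv f x * g x = f y * deriv g y - deriv f y * g y := by
  have hW (t : ℝ) : HasDerivAt (fun t => f t * deriv g t - deriv f t * g t) 0 t := by
    refine (((hf.1 t).hasDerivAt.mul (hg.2.1 t).hasDerivAt).sub
      ((hf.2.1 t).hasDerivAt.mul (hg.1 t).hasDerivAt)).congr_deriv ?_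
    linear_combination g t * hf.2.2 t - f t * hg.2.2 t
  exact is_const_of_deriv_eq_zero (fun t => (hW t).differentiableAt) (fun t => (hW t).deriv) x y

/-- Rescaling the variable of a Hill solution. -/
theorem IsHillSolution.comp_mul_left {V : ℝ → ℂ} {z : ℂ} {f : ℝ → ℂ}
    (hf : IsHillSolution V z f) (a : ℝ) {q : ℝ → ℂ} (hq : ∀ x, q x = (a : ℂ) ^ 2 * V (a * x)) :
    IsHillSolution q ((a : ℂ) ^ 2 * z) (fun x => f (a * x)) := by
  have hlin (x : ℝ) : HasDerivAt (fun x : ℝ => a * x) a x := by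
    simpa using (hasDerivAt_id x).const_mul a
  have h1 (x : ℝ) : HasDerivAt (fun x => f (a * x)) ((a : ℂ) * deriv f (a * x)) x := by
    simpa [Function.comp_def] using (hf.1 (a * x)).hasDerivAt.scomp x (hlin x)
  have h2 (x : ℝ) : HasDerivAt (fun x => (a : ℂ) * deriv f (a * x))
      ((a : ℂ) * ((a : ℂ) * deriv (deriv f) (a * x))) x := by
    simpa [Function.comp_def] using ((hf.2.1 (a * x)).hasDerivAt.scomp x (hlin x)).const_mul (a : ℂ)
  have hd : deriv (fun x => f (a * x)) = fun x => (a : ℂ) * deriv f (a * x) :=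
    funext fun x => (h1 x).deriv
  refine ⟨fun x => (h1 x).differentiableAt, ?_, fun x => ?_⟩
  · rw [hd]
    exact fun x => (h2 x).differentiableAt
  · rw [hd, (h2 x).deriv, hq]
    linear_combination (a : ℂ) ^ 2 * hf.2.2 (a * x)

/-- A nonzero Floquet multiplier `r` with period `T` determines the trace of the monodromy
matrix. -/
theorem IsHillSolution.trace_eq {q : ℝ → ℂ} {w r : ℂ} {T : ℝ} {f c s : ℝ → ℂ} (hr : r ≠ 0)
    (hf : IsHillSolution q w f) (hf0 : f ≠ 0) (hfT : ∀ x, f (x + T) = r * f x)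
    (hc : IsHillSolution q w c) (hc0 : c 0 = 1) (hc0' : deriv c 0 = 0)
    (hs : IsHillSolution q w s) (hs0 : s 0 = 0) (hs0' : deriv s 0 = 1) :
    c T + deriv s T = r + r⁻¹ := by
  have hcs (x : ℝ) : c x * deriv s x - deriv c x * s x = 1 := by
    simp [hc.wronskian_eq_s6 hs x 0, hc0, hs0, hs0']
  have hfs (x : ℝ) : f x * deriv s x - deriv f x * s x = f 0 := by
    simp [hf.wronskian_eq_s6 hs x 0, hs0, hs0']
  have hcf (x : ℝ) : c x * deriv f x - deriv c x * f x = deriv f 0 := by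
    simp [hc.wronskian_eq_s6 hf x 0, hc0, hc0']
  have hrep (x : ℝ) : f x = f 0 * c x + deriv f 0 * s x := by
    linear_combination -f x * hcs x + c x * hfs x + s x * hcf x
  have hrep' (x : ℝ) : deriv f x = f 0 * deriv c x + deriv f 0 * deriv s x := by
    linear_combination -deriv f x * hcs x + deriv c x * hfs x + deriv s x * hcf x
  have hT : f T = r * f 0 := by simpa using hfT 0
  have hT' : deriv f T = r * deriv f 0 := by
    have h := congrArg (fun g => deriv g 0) (funext hfT)
    simpa [deriv_comp_add_const, deriv_const_mul _ (hf.1 0)] using h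
  have e1 : (c T - r) * f 0 + s T * deriv f 0 = 0 := by
    linear_combination hT - hrep T
  have e2 : deriv c T * f 0 + (deriv s T - r) * deriv f 0 = 0 := by
    linear_combination hT' - hrep' T
  have hdet : r ^ 2 - r * (c T + deriv s T) + 1 = 0 := by
    by_contra hne
    have h0 : f 0 = 0 := (mul_eq_zero.mp (by
      linear_combination (deriv s T - r) * e1 - s T * e2 - f 0 * hcs T :
        (r ^ 2 - r * (c T + deriv s T) + 1) * f 0 = 0)).resolve_left hne
    have h0' : deriv f 0 = 0 := (mul_eq_zero.mp (by
      linear_combination (c T - r) * e2 - deriv c T * e1 - deriv f 0 * hcs T :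
        (r ^ 2 - r * (c T + deriv s T) + 1) * deriv f 0 = 0)).resolve_left hne
    exact hf0 (funext fun x => by simp [hrep x, h0, h0'])
  field_simp
  linear_combination -hdet

/-- If `ρ` is a Floquet multiplier of `-ψ'' + Vψ = zψ` and `qₙ(x) = n² V(nx)`, then the
Floquet discriminant of `qₙ` at `w = n² z` equals `ρⁿ + ρ⁻ⁿ`. -/
theorem scaled_discriminant
    (V : ℝ → ℂ) (hVcont : Continuous V)
    (hVper : ∀ x : ℝ, V (x + 2 * Real.pi) = V x)
    (z : ℂ) (n : ℕ) (hn : 0 < n)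
    (ψ : ℝ → ℂ) (ρ : ℂ) (hρ : ρ ≠ 0)
    (hψ : IsHillSolution V z ψ) (hψ0 : ψ ≠ 0)
    (hψper : ∀ x : ℝ, ψ (x + 2 * Real.pi) = ρ * ψ x)
    (qn : ℝ → ℂ) (hq : ∀ x : ℝ, qn x = (n : ℂ) ^ 2 * V ((n : ℝ) * x))
    (c s : ℝ → ℂ)
    (hc : IsHillSolution qn ((n : ℂ) ^ 2 * z) c) (hc0 : c 0 = 1) (hc0' : deriv c 0 = 0)
    (hs : IsHillSolution qn ((n : ℂ) ^ 2 * z) s) (hs0 : s 0 = 0) (hs0' : deriv s 0 = 1) :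
    c (2 * Real.pi) + deriv s (2 * Real.pi) = ρ ^ n + (ρ ^ n)⁻¹ := by
  have hiter (k : ℕ) (x : ℝ) : ψ (x + k * (2 * Real.pi)) = ρ ^ k * ψ x := by
    induction k with
    | zero => simp
    | succ k ih =>
      rw [show x + ((k + 1 : ℕ) : ℝ) * (2 * Real.pi) = x + k * (2 * Real.pi) + 2 * Real.pi by
        push_cast; ring, hψper, ih]
      ring
  have hφ : IsHillSolution qn ((n : ℂ) ^ 2 * z) (fun x => ψ (n * x)) := by
    simpa using hψ.comp_mul_left n (q := qn) (by simpa using hq)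
  have hφ0 : (fun x : ℝ => ψ (n * x)) ≠ 0 := by
    refine fun h => hψ0 (funext fun x => ?_)
    have hn' : (n : ℝ) ≠ 0 := by positivity
    simpa [mul_div_cancel₀ _ hn'] using congrFun h (x / n)
  exact hφ.trace_eq (pow_ne_zero n hρ) hφ0 (fun x => by rw [mul_add, hiter])
    hc hc0 hc0' hs hs0 hs0'
end
end

section
/- Let (a_k)_{k≥1} satisfy Σ_{k=1}^∞ |a_k| < ∞, let n ≥ 3 be an integer, and set q_n(x) = n² Σ_{k=1}^∞ a_k e^{iknx}. Define the Picard iterates u_0(x) = cos(x) and u_j(x) = ∫₀ˣ sin(x−t) q_n(t) u_{j−1}(t) dt for j ≥ 1. Then for every j ≥ 0 there exist complex coefficients (b_{j,ℓ})_{ℓ≥−1} with Σ_{ℓ=−1}^∞ |b_{j,ℓ}| < ∞ such that u_j(x) = Σ_{ℓ=−1}^∞ b_{j,ℓ} e^{iℓx} for all x ∈ ℝ, the series converging uniformly on ℝ. The same conclusion holds for the iterates v_j defined with v_0(x) = sin(x). -/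
noncomputable section

open Complex in
/-- Functions `∑_{ℓ ≥ -1} b_ℓ e^{iℓx}` with absolutely summable coefficients (`ℓ = m - 1`). -/
def IsExpSeries (f : ℝ → ℂ) : Prop :=
  ∃ b : ℕ → ℂ, Summable (fun m => ‖b m‖) ∧
    ∀ x : ℝ, HasSum (fun m : ℕ => b m * exp (I * ((m : ℂ) - 1) * (x : ℂ))) (f x)

namespace IsExpSeries

open Complex

lemma norm_exp_I_mul_sub_one (m : ℕ) (x : ℝ) : ‖exp (I * ((m : ℂ) - 1) * (x : ℂ))‖ = 1 := by
  simp [Complex.norm_exp]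

lemma norm_exp_I_mul_natCast (m : ℕ) (x : ℝ) : ‖exp (I * (m : ℂ) * (x : ℂ))‖ = 1 := by
  simp [Complex.norm_exp]

lemma hasSum_tsum {ι : Type*} {c : ι → ℂ} (hc : Summable fun i => ‖c i‖)
    {e : ι → ℂ} (he : ∀ i, ‖e i‖ = 1) : HasSum (fun i => c i * e i) (∑' i, c i * e i) :=
  (Summable.of_norm (by simpa [he] using hc)).hasSum

/-- Terms with equal exponents may be collected. -/
lemma of_hasSum {ι : Type*} {c : ι → ℂ} (hc : Summable fun i => ‖c i‖) (φ : ι → ℕ)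
    {f : ℝ → ℂ}
    (hf : ∀ x : ℝ, HasSum (fun i => c i * exp (I * ((φ i : ℂ) - 1) * (x : ℂ))) (f x)) :
    IsExpSeries f := by
  refine ⟨fun m => ∑' i : φ ⁻¹' {m}, c i, ?_, fun x => ?_⟩
  · refine Summable.of_nonneg_of_le (fun _ => norm_nonneg _)
      (fun m => norm_tsum_le_tsum_norm (hc.subtype _)) (hc.hasSum.tsum_fiberwise φ).summable
  · refine ((hf x).tsum_fiberwise φ).congr_fun fun m => ?_
    rw [← tsum_mul_right]
    refine tsum_congr fun i => ?_
    rw [show φ i = m from i.2]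

lemma add {f g : ℝ → ℂ} (hf : IsExpSeries f) (hg : IsExpSeries g) :
    IsExpSeries fun x => f x + g x := by
  obtain ⟨b, hb, hbf⟩ := hf
  obtain ⟨c, hc, hcg⟩ := hg
  refine ⟨fun m => b m + c m, Summable.of_nonneg_of_le (fun _ => norm_nonneg _)
    (fun m => norm_add_le _ _) (hb.add hc), fun x => ?_⟩
  simpa only [add_mul] using (hbf x).add (hcg x)

lemma const_mul_exp (A : ℂ) (k : ℕ) :
    IsExpSeries fun x => A * exp (I * ((k : ℂ) - 1) * (x : ℂ)) :=
  of_hasSum (ι := Unit) (c := fun _ => A) (hasSum_fintype _).summable (fun _ => k) fun x => by simp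

lemma cos_add_sin (A B : ℂ) :
    IsExpSeries fun x : ℝ => A * cos (x : ℂ) + B * sin (x : ℂ) := by
  convert (const_mul_exp ((A - B * I) / 2) 2).add (const_mul_exp ((A + B * I) / 2) 0) using 2
    with x
  have h₁ : I * (((2 : ℕ) : ℂ) - 1) * (x : ℂ) = x * I := by push_cast; ring
  have h₂ : I * (((0 : ℕ) : ℂ) - 1) * (x : ℂ) = -x * I := by push_cast; ring
  rw [h₁, h₂, Complex.cos, Complex.sin]
  ring

lemma integral_sin_sub_mul_exp {l : ℕ} (hl : 2 ≤ l) (x : ℝ) :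
    ∫ t in (0 : ℝ)..x, (Real.sin (x - t) : ℂ) * exp (I * (l : ℂ) * (t : ℂ)) =
      (exp (I * (l : ℂ) * (x : ℂ)) - cos x - I * l * sin x) / (1 - (l : ℂ) ^ 2) := by
  have hne : (1 - (l : ℂ) ^ 2) ≠ 0 := by
    rw [sub_ne_zero]
    norm_cast
    nlinarith
  have key : ∀ t : ℝ, HasDerivAt
      (fun t : ℝ => exp (I * (l : ℂ) * (t : ℂ)) *
        (cos ((x : ℂ) - t) + I * l * sin ((x : ℂ) - t)) / (1 - (l : ℂ) ^ 2))
      ((Real.sin (x - t) : ℂ) * exp (I * (l : ℂ) * (t : ℂ))) t := by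
    intro t
    have h₁ : HasDerivAt (fun z : ℂ => exp (I * (l : ℂ) * z))
        (exp (I * (l : ℂ) * (t : ℂ)) * (I * l)) (t : ℂ) := by
      simpa using ((hasDerivAt_id (t : ℂ)).const_mul (I * (l : ℂ))).cexp
    have h₀ : HasDerivAt (fun z : ℂ => (x : ℂ) - z) (-1) (t : ℂ) := by
      simpa using (hasDerivAt_id (t : ℂ)).const_sub (x : ℂ)
    have h := ((h₁.mul (h₀.ccos.add (h₀.csin.const_mul (I * (l : ℂ))))).div_const
      (1 - (l : ℂ) ^ 2)).comp_ofReal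
    refine h.congr_deriv ?_
    rw [div_eq_iff hne]
    simp only [Pi.add_apply]
    push_cast
    linear_combination ((l : ℂ) ^ 2 * exp (I * (l : ℂ) * (t : ℂ)) * sin ((x : ℂ) - t)) * I_sq
  rw [intervalIntegral.integral_eq_sub_of_hasDerivAt (fun t _ => key t)
    (Continuous.intervalIntegrable (by fun_prop) _ _)]
  simp only [sub_self, ofReal_zero, mul_zero, sub_zero, Complex.cos_zero, Complex.sin_zero,
    Complex.exp_zero]
  ring

lemma natCast_le_norm_one_sub_sq {l : ℕ} (hl : 2 ≤ l) : (l : ℝ) ≤ ‖1 - (l : ℂ) ^ 2‖ := by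
  have h : (2 : ℝ) ≤ l := by exact_mod_cast hl
  have : (1 - (l : ℂ) ^ 2) = ((1 - (l : ℝ) ^ 2 : ℝ) : ℂ) := by push_cast; ring
  rw [this, norm_real, Real.norm_eq_abs, abs_sub_comm]
  exact le_trans (by nlinarith) (le_abs_self _)

/-- The resolvent of `y'' + y` at zero initial data maps frequencies `≥ 2` to frequencies
`≥ -1`. -/
lemma integral_sin_sub_mul {ι : Type*} [Countable ι] {c : ι → ℂ} (hc : Summable fun i => ‖c i‖)
    {φ : ι → ℕ} (hφ : ∀ i, 2 ≤ φ i) {f : ℝ → ℂ}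
    (hf : ∀ t : ℝ, HasSum (fun i => c i * exp (I * (φ i : ℂ) * (t : ℂ))) (f t)) :
    IsExpSeries fun x => ∫ t in (0 : ℝ)..x, (Real.sin (x - t) : ℂ) * f t := by
  set d : ι → ℂ := fun i => c i / (1 - (φ i : ℂ) ^ 2) with hd_def
  have hld : Summable fun i => ‖d i * φ i‖ := by
    refine Summable.of_nonneg_of_le (fun _ => norm_nonneg _) (fun i => ?_) hc
    have h := natCast_le_norm_one_sub_sq (hφ i)
    have h₂ : (2 : ℝ) ≤ φ i := by exact_mod_cast hφ i
    rw [hd_def, norm_mul, norm_div, norm_natCast, div_mul_eq_mul_div,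
      div_le_iff₀ (by linarith)]
    gcongr
  have hd : Summable fun i => ‖d i‖ := by
    refine Summable.of_nonneg_of_le (fun _ => norm_nonneg _) (fun i => ?_) hld
    have h₂ : (2 : ℝ) ≤ φ i := by exact_mod_cast hφ i
    rw [norm_mul, norm_natCast]
    exact le_mul_of_one_le_right (norm_nonneg _) (by linarith)
  have hint (x : ℝ) : HasSum
      (fun i => ∫ t in (0 : ℝ)..x, (Real.sin (x - t) : ℂ) *
        (c i * exp (I * (φ i : ℂ) * (t : ℂ))))
      (∫ t in (0 : ℝ)..x, (Real.sin (x - t) : ℂ) * f t) := by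
    refine intervalIntegral.hasSum_integral_of_dominated_convergence (fun i _ => ‖c i‖)
      (fun i => Continuous.aestronglyMeasurable (by fun_prop))
      (fun i => Filter.Eventually.of_forall fun t _ => ?_)
      (Filter.Eventually.of_forall fun t _ => hc) intervalIntegrable_const
      (Filter.Eventually.of_forall fun t _ => (hf t).mul_left _)
    rw [norm_mul, norm_mul, norm_exp_I_mul_natCast, mul_one, norm_real]
    exact mul_le_of_le_one_left (norm_nonneg _) (Real.abs_sin_le_one _)
  have hexp : IsExpSeries fun x : ℝ => ∑' i, d i * exp (I * (φ i : ℂ) * (x : ℂ)) :=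
    of_hasSum hd (fun i => φ i + 1) fun x => by
      simpa using hasSum_tsum hd fun i => norm_exp_I_mul_natCast (φ i) x
  convert hexp.add (cos_add_sin (-∑' i, d i) (-(∑' i, d i * φ i) * I)) using 2 with x
  refine (hint x).unique ?_
  convert ((hasSum_tsum hd fun i => norm_exp_I_mul_natCast (φ i) x).add
    (((Summable.of_norm hd).hasSum.neg.mul_right (cos (x : ℂ))).add
      (((Summable.of_norm hld).hasSum.neg.mul_right I).mul_right (sin (x : ℂ))))) using 2 with i
  simp only [mul_left_comm _ (c i)]
  rw [intervalIntegral.integral_const_mul, integral_sin_sub_mul_exp (hφ i)]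
  simp only [hd_def]
  ring

lemma picard_step {a : ℕ → ℂ} (ha : Summable fun k => ‖a k‖) {n : ℕ} (hn : 3 ≤ n)
    {q : ℝ → ℂ}
    (hq : ∀ x : ℝ, q x =
      (n : ℂ) ^ 2 * ∑' k : ℕ, a k * exp (I * (((k : ℂ) + 1) * n) * (x : ℂ)))
    {f : ℝ → ℂ} (hf : IsExpSeries f) :
    IsExpSeries fun x => ∫ t in (0 : ℝ)..x, (Real.sin (x - t) : ℂ) * q t * f t := by
  obtain ⟨b, hb, hbf⟩ := hf
  have hfreq (p : ℕ × ℕ) : 3 ≤ (p.1 + 1) * n + p.2 := by nlinarith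
  have hab : Summable fun p : ℕ × ℕ => ‖a p.1 * b p.2‖ := ha.mul_norm hb
  simp only [mul_assoc]
  refine integral_sin_sub_mul (c := fun p : ℕ × ℕ => (n : ℂ) ^ 2 * (a p.1 * b p.2))
    (φ := fun p => (p.1 + 1) * n + p.2 - 1) ?_ (fun p => ?_) fun t => ?_
  · simpa only [norm_mul _ (_ * _)] using hab.mul_left ‖(n : ℂ) ^ 2‖
  · have := hfreq p
    omega
  · have he (k : ℕ) : ‖exp (I * (((k : ℂ) + 1) * n) * (t : ℂ))‖ = 1 := by
      simpa using norm_exp_I_mul_natCast ((k + 1) * n) t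
    have hA : Summable fun k => ‖a k * exp (I * (((k : ℂ) + 1) * n) * (t : ℂ))‖ := by
      simpa [he] using ha
    have hB : Summable fun m : ℕ => ‖b m * exp (I * ((m : ℂ) - 1) * (t : ℂ))‖ := by
      simpa [norm_exp_I_mul_sub_one] using hb
    rw [hq, mul_assoc]
    have hAB := summable_mul_of_summable_norm hA hB
    have hprod := hA.of_norm.hasSum.mul (hbf t) hAB
    refine (hprod.mul_left ((n : ℂ) ^ 2)).congr_fun fun p => ?_
    rw [Nat.cast_sub (by linarith [hfreq p])]
    have hexp : I * ((((p.1 + 1) * n + p.2 : ℕ) : ℂ) - (1 : ℕ)) * (t : ℂ) =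
        I * (((p.1 : ℂ) + 1) * n) * (t : ℂ) + I * ((p.2 : ℂ) - 1) * (t : ℂ) := by
      push_cast; ring
    rw [hexp, Complex.exp_add]
    ring

lemma exists_tendstoUniformly {f : ℝ → ℂ} (hf : IsExpSeries f) :
    ∃ b : ℕ → ℂ, Summable (fun m => ‖b m‖) ∧
      (∀ x : ℝ, f x = ∑' m : ℕ, b m * exp (I * ((m : ℂ) - 1) * (x : ℂ))) ∧
      TendstoUniformly
        (fun N (x : ℝ) => ∑ m ∈ Finset.range N, b m * exp (I * ((m : ℂ) - 1) * (x : ℂ)))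
        f Filter.atTop := by
  obtain ⟨b, hb, hbf⟩ := hf
  refine ⟨b, hb, fun x => (hbf x).tsum_eq.symm, ?_⟩
  rw [show f = _ from funext fun x => (hbf x).tsum_eq.symm]
  exact tendstoUniformly_tsum_nat hb fun m x => by
    rw [norm_mul, norm_exp_I_mul_sub_one, mul_one]

lemma picard_iterate {a : ℕ → ℂ} (ha : Summable fun k => ‖a k‖) {n : ℕ} (hn : 3 ≤ n)
    {q : ℝ → ℂ}
    (hq : ∀ x : ℝ, q x =
      (n : ℂ) ^ 2 * ∑' k : ℕ, a k * exp (I * (((k : ℂ) + 1) * n) * (x : ℂ)))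
    {u : ℕ → ℝ → ℂ} (h0 : IsExpSeries (u 0))
    (hu : ∀ (j : ℕ) (x : ℝ),
      u (j + 1) x = ∫ t in (0 : ℝ)..x, (Real.sin (x - t) : ℂ) * q t * u j t) (j : ℕ) :
    IsExpSeries (u j) := by
  induction j with
  | zero => exact h0
  | succ j ih => exact funext (hu j) ▸ picard_step ha hn hq ih

end IsExpSeries

/-- For `qₙ(x) = n² ∑_{k=1}^∞ a_k e^{iknx}` with `∑|a_k| < ∞` and `n ≥ 3`, each Picard
iterate `u_j` (and `v_j`) is a uniformly convergent series `∑_{ℓ ≥ -1} b_{j,ℓ} e^{iℓx}`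
with absolutely summable coefficients (here `ℓ = m - 1`, `m : ℕ`). -/
theorem picard_iterates_are_exponential_series
    (a : ℕ → ℂ) (ha : Summable fun k => ‖a k‖)
    (n : ℕ) (hn : 3 ≤ n)
    (qn : ℝ → ℂ)
    (hq : ∀ x : ℝ, qn x =
      (n : ℂ) ^ 2 * ∑' k : ℕ, a k * Complex.exp (Complex.I * (((k : ℂ) + 1) * n) * (x : ℂ)))
    (u v : ℕ → ℝ → ℂ)
    (hu0 : ∀ x : ℝ, u 0 x = (Real.cos x : ℂ))
    (hu : ∀ (j : ℕ) (x : ℝ),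
      u (j + 1) x = ∫ t in (0 : ℝ)..x, (Real.sin (x - t) : ℂ) * qn t * u j t)
    (hv0 : ∀ x : ℝ, v 0 x = (Real.sin x : ℂ))
    (hv : ∀ (j : ℕ) (x : ℝ),
      v (j + 1) x = ∫ t in (0 : ℝ)..x, (Real.sin (x - t) : ℂ) * qn t * v j t) :
    (∀ j : ℕ, ∃ b : ℕ → ℂ, Summable (fun m => ‖b m‖) ∧
        (∀ x : ℝ, u j x = ∑' m : ℕ, b m * Complex.exp (Complex.I * ((m : ℂ) - 1) * (x : ℂ))) ∧
        TendstoUniformly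
          (fun N (x : ℝ) => ∑ m ∈ Finset.range N, b m * Complex.exp (Complex.I * ((m : ℂ) - 1) * (x : ℂ)))
          (u j) Filter.atTop) ∧
      (∀ j : ℕ, ∃ b : ℕ → ℂ, Summable (fun m => ‖b m‖) ∧
        (∀ x : ℝ, v j x = ∑' m : ℕ, b m * Complex.exp (Complex.I * ((m : ℂ) - 1) * (x : ℂ))) ∧
        TendstoUniformly
          (fun N (x : ℝ) => ∑ m ∈ Finset.range N, b m * Complex.exp (Complex.I * ((m : ℂ) - 1) * (x : ℂ)))
          (v j) Filter.atTop) := by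
  have hu_zero : IsExpSeries (u 0) := by
    convert IsExpSeries.cos_add_sin 1 0 using 2 with x
    simp [hu0]
  have hv_zero : IsExpSeries (v 0) := by
    convert IsExpSeries.cos_add_sin 0 1 using 2 with x
    simp [hv0]
  exact ⟨fun j => (IsExpSeries.picard_iterate ha hn hq hu_zero hu j).exists_tendstoUniformly,
    fun j => (IsExpSeries.picard_iterate ha hn hq hv_zero hv j).exists_tendstoUniformly⟩
end
end
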